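/- arXiv:1301.1471 — 4 statements merged into one kernel-verified Lean document; each statement's English description precedes it below -/
import Mathlib

section
/- Let X be a random variable uniformly distributed on [-100, 200]. Then the function φ(λ) = E[log(1 + λX)] satisfies φ(λ) > 0 for every λ ∈ (0, 1/100]; in particular, the equation E[log(1 + λX)] = 0 has no solution λ > 0. -/
open MeasureTheory

/-- The antiderivative difference of `log` between `1 - t` and `1 + 2t` is positive. -/
theorem entropy_gap_pos {t : ℝ} (ht : 0 < t) (ht1 : t ≤ 1) :
    0 < (1 + 2 * t) * Real.log (1 + 2 * t) - (1 - t) * Real.log (1 - t) - 3 * t := by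
  rcases ht1.eq_or_lt with rfl | h
  · have h3 : 1 < Real.log 3 := by
      rw [Real.lt_log_iff_exp_lt (by norm_num)]
      linarith [Real.exp_one_lt_d9]
    norm_num
    linarith
  · have h1t : 0 < 1 - t := by linarith
    have hupper := Real.le_log_one_add_of_nonneg (show 0 ≤ 2 * t by linarith)
    have hlower := Real.le_log_one_add_of_nonneg (div_pos ht h1t).le
    have hinv : 1 + t / (1 - t) = (1 - t)⁻¹ := by field_simp; ring
    rw [hinv, Real.log_inv] at hlower
    have hupper' := mul_le_mul_of_nonneg_left hupper (show 0 ≤ 1 + 2 * t by linarith)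
    have hlower' := mul_le_mul_of_nonneg_left hlower h1t.le
    have h2t : 0 < 2 - t := by linarith
    have hne : 2 - t ≠ 0 := h2t.ne'
    have hsum : t / (1 - t) + 2 = (2 - t) / (1 - t) := by field_simp; ring
    rw [hsum] at hlower'
    have hrational : (1 + 2 * t) * (2 * (2 * t) / (2 * t + 2))
        + (1 - t) * (2 * (t / (1 - t)) / ((2 - t) / (1 - t))) - 3 * t
        = 3 * t ^ 2 * (1 - t) / ((1 + t) * (2 - t)) := by
      have : 2 * t + 2 ≠ 0 := by positivity
      have : 1 + t ≠ 0 := by positivity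
      field_simp
      ring
    have hpos : 0 < 3 * t ^ 2 * (1 - t) / ((1 + t) * (2 - t)) := by positivity
    linarith

theorem integral_log_one_add_mul_pos {lam : ℝ} (h0 : 0 < lam) (h1 : lam ≤ 1 / 100) :
    0 < ∫ x in (-100 : ℝ)..200, Real.log (1 + lam * x) := by
  rw [intervalIntegral.integral_comp_add_mul Real.log h0.ne', integral_log, smul_eq_mul]
  have h := entropy_gap_pos (t := 100 * lam) (by linarith) (by linarith)
  refine mul_pos (inv_pos.mpr h0) ?_
  rw [show 1 + lam * 200 = 1 + 2 * (100 * lam) by ring,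
    show 1 + lam * (-100) = 1 - 100 * lam by ring]
  linarith

/-- For `X` uniformly distributed on `[-100, 200]`, the function
`φ(λ) = E[log(1 + λX)]` satisfies `φ(λ) > 0` for every `λ ∈ (0, 1/100]`; in particular
the Foster–Hart equation `E[log(1 + λX)] = 0` has no solution `λ > 0`
(the equation only makes sense for `λ ≤ 1/100 = 1/L(X)`). -/
theorem uniform_no_positive_root
    {Ω : Type*} [MeasurableSpace Ω] (P : Measure Ω) [IsProbabilityMeasure P]
    (X : Ω → ℝ) (hX : Measurable X)
    (hlaw : Measure.map X P
      = (300 : ENNReal)⁻¹ • volume.restrict (Set.Icc (-100 : ℝ) 200)) :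
    (∀ lam ∈ Set.Ioc (0 : ℝ) (1 / 100),
      0 < ∫ ω, Real.log (1 + lam * X ω) ∂P) ∧
    ¬ ∃ lam : ℝ, 0 < lam ∧ lam ≤ 1 / 100 ∧
      (∫ ω, Real.log (1 + lam * X ω) ∂P) = 0 := by
  have hpos : ∀ lam ∈ Set.Ioc (0 : ℝ) (1 / 100),
      0 < ∫ ω, Real.log (1 + lam * X ω) ∂P := by
    rintro lam ⟨h0, h1⟩
    have hmeas : Measurable fun x : ℝ => Real.log (1 + lam * x) := by fun_prop
    rw [← integral_map hX.aemeasurable (f := fun x : ℝ => Real.log (1 + lam * x))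
      hmeas.aestronglyMeasurable, hlaw, integral_smul_measure, integral_Icc_eq_integral_Ioc,
      ← intervalIntegral.integral_of_le (by norm_num), smul_eq_mul]
    exact mul_pos (by simp) (integral_log_one_add_mul_pos h0 h1)
  refine ⟨hpos, ?_⟩
  rintro ⟨lam, h0, h1, h⟩
  exact (hpos lam ⟨h0, h1⟩).ne' h
end

section
/- Let X be a random variable with finitely many values satisfying E[X] > 0 and P(X < 0) > 0, and let L = max(−X) > 0 be its maximal loss. Then the function φ(λ) = E[log(1 + λX)] is strictly concave on [0, 1/L), has strictly positive derivative at 0, tends to −∞ as λ ↑ 1/L, and possesses a unique zero λ in the open interval (0, 1/L). -/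
open MeasureTheory Filter

/-- The expectation of a function of a finite-valued random variable, as a finite sum. -/
lemma integral_comp_eq_sum_of_finite_range {Ω : Type*} [MeasurableSpace Ω] (P : Measure Ω)
    [IsFiniteMeasure P] {X : Ω → ℝ} (hX : Measurable X) (hfin : (Set.range X).Finite)
    (g : ℝ → ℝ) :
    ∫ ω, g (X ω) ∂P = ∑ x ∈ hfin.toFinset, P.real (X ⁻¹' {x}) * g x := by
  have hms (x : ℝ) : MeasurableSet (X ⁻¹' {x}) := hX (measurableSet_singleton x)
  have h : ∀ ω, g (X ω) =
      ∑ x ∈ hfin.toFinset, (X ⁻¹' {x}).indicator (fun _ => g x) ω := by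
    intro ω
    rw [Finset.sum_eq_single_of_mem (X ω) (by simp)]
    · simp
    · intro x _ hx
      exact Set.indicator_of_notMem (by simpa using hx.symm) _
  simp_rw [h]
  rw [integral_finsetSum _ fun x _ => (integrable_const (g x)).indicator (hms x)]
  exact Finset.sum_congr rfl fun x _ => by rw [integral_indicator_const _ (hms x), smul_eq_mul]

lemma one_add_mul_pos_of_mem_Ico {L lam x : ℝ} (hL : 0 < L)
    (hlam : lam ∈ Set.Ico (0 : ℝ) (1 / L)) (hx : -L ≤ x) : 0 < 1 + lam * x := by
  have := (lt_div_iff₀ hL).1 hlam.2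
  nlinarith [mul_le_mul_of_nonneg_left hx hlam.1]

section FiniteSum

variable {S : Finset ℝ} {p : ℝ → ℝ} {L : ℝ}

lemma strictConcaveOn_sum_mul_log (hp : ∀ x, 0 ≤ p x) (hL : 0 < L) (hS : ∀ x ∈ S, -L ≤ x)
    (hLS : -L ∈ S) (hpL : 0 < p (-L)) :
    StrictConcaveOn ℝ (Set.Ico (0 : ℝ) (1 / L))
      (fun lam => ∑ x ∈ S, p x * Real.log (1 + lam * x)) := by
  refine ⟨convex_Ico _ _, fun u hu v hv huv a b ha hb hab => ?_⟩
  have key (x : ℝ) : 1 + (a • u + b • v) * x = a • (1 + u * x) + b • (1 + v * x) := by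
    simp only [smul_eq_mul]
    linear_combination (-1 : ℝ) * hab
  simp only [smul_eq_mul, Finset.mul_sum] at key ⊢
  rw [← Finset.sum_add_distrib]
  refine Finset.sum_lt_sum (fun x hx => ?_) ⟨-L, hLS, ?_⟩
  · have h := strictConcaveOn_log_Ioi.concaveOn.2
      (one_add_mul_pos_of_mem_Ico hL hu (hS x hx)) (one_add_mul_pos_of_mem_Ico hL hv (hS x hx))
      ha.le hb.le hab
    simp only [smul_eq_mul] at h
    rw [key]
    linarith [mul_le_mul_of_nonneg_left h (hp x)]
  · have hne : 1 + u * -L ≠ 1 + v * -L := fun h =>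
      huv (mul_right_cancel₀ (neg_ne_zero.2 hL.ne') (add_left_cancel h))
    have h := strictConcaveOn_log_Ioi.2
      (one_add_mul_pos_of_mem_Ico hL hu le_rfl) (one_add_mul_pos_of_mem_Ico hL hv le_rfl)
      hne ha hb hab
    simp only [smul_eq_mul] at h
    rw [key]
    linarith [mul_lt_mul_of_pos_left h hpL]

lemma hasDerivAt_sum_mul_log_zero (S : Finset ℝ) (p : ℝ → ℝ) :
    HasDerivAt (fun lam => ∑ x ∈ S, p x * Real.log (1 + lam * x)) (∑ x ∈ S, p x * x) 0 := by
  refine HasDerivAt.fun_sum fun x _ => HasDerivAt.const_mul _ ?_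
  have h : HasDerivAt (fun lam : ℝ => 1 + lam * x) x 0 := by
    simpa using ((hasDerivAt_id (0 : ℝ)).mul_const x).const_add 1
  simpa using h.log (by simp)

lemma continuousOn_sum_mul_log (hL : 0 < L) (hS : ∀ x ∈ S, -L ≤ x) :
    ContinuousOn (fun lam => ∑ x ∈ S, p x * Real.log (1 + lam * x))
      (Set.Ico (0 : ℝ) (1 / L)) :=
  continuousOn_finsetSum _ fun x hx => continuousOn_const.mul <|
    ContinuousOn.log (by fun_prop) fun _ hlam =>
      (one_add_mul_pos_of_mem_Ico hL hlam (hS x hx)).ne'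

lemma tendsto_sum_mul_log_atBot (hp : ∀ x, 0 ≤ p x) (hL : 0 < L) (hS : ∀ x ∈ S, -L ≤ x)
    (hLS : -L ∈ S) (hpL : 0 < p (-L)) :
    Tendsto (fun lam => ∑ x ∈ S, p x * Real.log (1 + lam * x))
      (nhdsWithin (1 / L) (Set.Iio (1 / L))) atBot := by
  have hIco : ∀ᶠ lam in nhdsWithin (1 / L) (Set.Iio (1 / L)), lam ∈ Set.Ico (0 : ℝ) (1 / L) :=
    Ico_mem_nhdsLT (by positivity)
  have hlin : Tendsto (fun lam : ℝ => 1 + lam * -L) (nhdsWithin (1 / L) (Set.Iio (1 / L)))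
      (nhdsWithin 0 (Set.Ioi 0)) := by
    refine tendsto_nhdsWithin_iff.2 ⟨Tendsto.mono_left ?_ nhdsWithin_le_nhds, ?_⟩
    · have h : Continuous fun lam : ℝ => 1 + lam * -L := by fun_prop
      simpa [hL.ne'] using h.tendsto (1 / L)
    · filter_upwards [hIco] with lam hlam
      exact one_add_mul_pos_of_mem_Ico hL hlam le_rfl
  have hmain : Tendsto (fun lam : ℝ => p (-L) * Real.log (1 + lam * -L) +
      ∑ x ∈ S.erase (-L), p x * Real.log (1 + 1 / L * |x|))
      (nhdsWithin (1 / L) (Set.Iio (1 / L))) atBot :=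
    tendsto_atBot_add_const_right _ _
      ((Real.tendsto_log_nhdsGT_zero.comp hlin).const_mul_atBot hpL)
  refine tendsto_atBot_mono' _ ?_ hmain
  filter_upwards [hIco] with lam hlam
  rw [← Finset.add_sum_erase S _ hLS]
  refine add_le_add_right (Finset.sum_le_sum fun x hx => mul_le_mul_of_nonneg_left ?_ (hp x)) _
  refine Real.log_le_log
    (one_add_mul_pos_of_mem_Ico hL hlam (hS x (Finset.mem_of_mem_erase hx))) ?_
  exact add_le_add_right ((mul_le_mul_of_nonneg_left (le_abs_self x) hlam.1).trans
    (mul_le_mul_of_nonneg_right hlam.2.le (abs_nonneg x))) 1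

end FiniteSum

/-- A strictly concave continuous function on `[0, b)` which vanishes at `0` with positive
derivative and tends to `-∞` at `b` has exactly one zero in `(0, b)`. -/
lemma StrictConcaveOn.existsUnique_zero_Ioo {f : ℝ → ℝ} {b d : ℝ} (hb : 0 < b)
    (hf : StrictConcaveOn ℝ (Set.Ico 0 b) f) (hcont : ContinuousOn f (Set.Ico 0 b))
    (h0 : f 0 = 0) (hd : 0 < d) (hderiv : HasDerivAt f d 0)
    (hlim : Tendsto f (nhdsWithin b (Set.Iio b)) atBot) :
    ∃! t, t ∈ Set.Ioo 0 b ∧ f t = 0 := by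
  have hmem0 : (0 : ℝ) ∈ Set.Ico 0 b := ⟨le_rfl, hb⟩
  have hpos : ∀ u v, 0 < u → u < v → v < b → f v = 0 → 0 < f u := by
    intro u v hu huv hvb hv
    have h := hf.slope_anti_adjacent hmem0 ⟨(hu.trans huv).le, hvb⟩ hu huv
    rw [h0, hv, sub_zero, sub_zero, zero_sub] at h
    by_contra! hle
    have h1 : f u / u ≤ 0 := div_nonpos_of_nonpos_of_nonneg hle hu.le
    have h2 : 0 ≤ -f u / (v - u) := div_nonneg (neg_nonneg.2 hle) (sub_pos.2 huv).le
    linarith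
  obtain ⟨u, hfu, hu⟩ : ∃ u, 0 < f u ∧ u ∈ Set.Ioo 0 b := by
    have h : ∀ᶠ t in nhdsWithin 0 (Set.Ioi 0), 0 < slope f 0 t :=
      ((hasDerivAt_iff_tendsto_slope.1 hderiv).mono_left
        (nhdsWithin_mono _ fun t (ht : 0 < t) => ht.ne')).eventually_const_lt hd
    obtain ⟨t, ht, htb⟩ := (h.and (Ioo_mem_nhdsGT hb)).exists
    rw [slope_def_field, h0, sub_zero, sub_zero] at ht
    exact ⟨t, (div_pos_iff_of_pos_right htb.1).1 ht, htb⟩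
  obtain ⟨v, hfv, hv⟩ : ∃ v, f v < 0 ∧ v ∈ Set.Ioo u b :=
    ((hlim.eventually_lt_atBot 0).and (Ioo_mem_nhdsLT hu.2)).exists
  obtain ⟨t, ht, hft⟩ := intermediate_value_Ioo' hv.1.le
    (hcont.mono fun s hs => ⟨hu.1.le.trans hs.1, hs.2.trans_lt hv.2⟩) ⟨hfv, hfu⟩
  refine ⟨t, ⟨⟨hu.1.trans ht.1, ht.2.trans hv.2⟩, hft⟩, ?_⟩
  rintro s ⟨hs, hfs⟩
  rcases lt_trichotomy s t with h | h | h
  · exact absurd hfs (hpos s t hs.1 h (ht.2.trans hv.2) hft).ne'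
  · exact h
  · exact absurd hft (hpos t s (hu.1.trans ht.1) h hs.2 hfs).ne'

/-- for a finite-valued gamble `X` (`E X > 0`, `P(X<0) > 0`) with maximal
loss `L = max(−X) > 0` (attained with positive probability), the function
`φ(λ) = E[log(1 + λX)]` is strictly concave on `[0, 1/L)`, has strictly positive
derivative at `0`, tends to `−∞` as `λ ↑ 1/L`, and has a unique zero in `(0, 1/L)`. -/
theorem fosterHart_root_exists_discrete
    {Ω : Type*} [MeasurableSpace Ω] (P : Measure Ω) [IsProbabilityMeasure P]
    (X : Ω → ℝ) (hXmeas : Measurable X) (hXfin : (Set.range X).Finite)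
    (hEX : 0 < ∫ ω, X ω ∂P) (hneg : 0 < P {ω | X ω < 0})
    (L : ℝ) (hLpos : 0 < L) (hLmax : ∀ ω, -X ω ≤ L)
    (hLatt : 0 < P {ω | X ω = -L}) :
    StrictConcaveOn ℝ (Set.Ico (0 : ℝ) (1 / L))
      (fun lam => ∫ ω, Real.log (1 + lam * X ω) ∂P) ∧
    (∃ d : ℝ, 0 < d ∧
      HasDerivAt (fun lam => ∫ ω, Real.log (1 + lam * X ω) ∂P) d 0) ∧
    Tendsto (fun lam => ∫ ω, Real.log (1 + lam * X ω) ∂P)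
      (nhdsWithin (1 / L) (Set.Iio (1 / L))) atBot ∧
    (∃! lam : ℝ, lam ∈ Set.Ioo (0 : ℝ) (1 / L) ∧
      (∫ ω, Real.log (1 + lam * X ω) ∂P) = 0) := by
  have hsum := integral_comp_eq_sum_of_finite_range P hXmeas hXfin
  have hmean : 0 < ∑ x ∈ hXfin.toFinset, P.real (X ⁻¹' {x}) * x := by
    rwa [← hsum fun x => x]
  have hpL : 0 < P.real (X ⁻¹' {-L}) := ENNReal.toReal_pos hLatt.ne' (measure_ne_top _ _)
  have hLS : -L ∈ hXfin.toFinset := by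
    obtain ⟨ω, hω⟩ := nonempty_of_measure_ne_zero hLatt.ne'
    exact hXfin.mem_toFinset.2 ⟨ω, hω⟩
  have hS : ∀ x ∈ hXfin.toFinset, -L ≤ x := by
    intro x hx
    obtain ⟨ω, rfl⟩ := hXfin.mem_toFinset.1 hx
    exact neg_le.1 (hLmax ω)
  have hp (x : ℝ) : 0 ≤ P.real (X ⁻¹' {x}) := measureReal_nonneg
  simp_rw [fun lam => hsum fun x => Real.log (1 + lam * x)]
  have hconc := strictConcaveOn_sum_mul_log hp hLpos hS hLS hpL
  have hderiv := hasDerivAt_sum_mul_log_zero hXfin.toFinset fun x => P.real (X ⁻¹' {x})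
  have hlim := tendsto_sum_mul_log_atBot hp hLpos hS hLS hpL
  exact ⟨hconc, ⟨_, hmean, hderiv⟩, hlim, hconc.existsUnique_zero_Ioo (one_div_pos.2 hLpos)
    (continuousOn_sum_mul_log hLpos hS) (by simp) hmean hderiv hlim⟩
end

section
/- Let X and Y be finite-valued random variables with E[X] > 0, P(X < 0) > 0, E[Y] > 0, P(Y < 0) > 0, and suppose X ≤ Y almost surely. Let λ_X ∈ (0, 1/L(X)) and λ_Y ∈ (0, 1/L(Y)) be the unique positive solutions of E[log(1 + λ_X X)] = 0 and E[log(1 + λ_Y Y)] = 0 respectively. Then λ_X ≤ λ_Y; equivalently, the Foster–Hart riskiness satisfies R(Y) ≤ R(X). -/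
open MeasureTheory

/-- A measurable function with finite range is integrable for a finite measure. -/
theorem integrable_of_finite_range {Ω : Type*} [MeasurableSpace Ω] {P : Measure Ω}
    [IsFiniteMeasure P] {f : Ω → ℝ} (hf : Measurable f) (hfin : (Set.range f).Finite) :
    Integrable f P := by
  obtain ⟨C, hC⟩ := hfin.isBounded.exists_norm_le
  exact Integrable.of_bound hf.aestronglyMeasurable C
    (Filter.Eventually.of_forall fun ω => hC _ ⟨ω, rfl⟩)

/-- The logarithmic growth `log (1 + c * f)` of a finite-valued function is integrable. -/
theorem integrable_log_one_add_mul_of_finite_range {Ω : Type*} [MeasurableSpace Ω]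
    {P : Measure Ω} [IsFiniteMeasure P] {f : Ω → ℝ} (hf : Measurable f)
    (hfin : (Set.range f).Finite) (c : ℝ) :
    Integrable (fun ω => Real.log (1 + c * f ω)) P := by
  refine integrable_of_finite_range (by fun_prop) ?_
  refine (hfin.image fun x => Real.log (1 + c * x)).subset ?_
  rintro _ ⟨ω, rfl⟩
  exact ⟨f ω, ⟨ω, rfl⟩, rfl⟩

/-- Strict Bernoulli inequality in logarithmic form. -/
theorem mul_log_one_add_lt_log_one_add_mul {s t : ℝ} (hs : -1 < s) (hs0 : s ≠ 0)
    (ht0 : 0 < t) (ht1 : t < 1) : t * Real.log (1 + s) < Real.log (1 + t * s) := by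
  have h1 : 0 < 1 + s := by linarith
  rw [← Real.log_rpow h1]
  exact Real.log_lt_log (Real.rpow_pos_of_pos h1 t)
    (rpow_one_add_lt_one_add_mul_self hs.le hs0 ht0 ht1)

/-- Below a positive zero `l` of the expected log-growth of a finite-valued `X` with
`1 + l * X > 0`, the expected log-growth is positive. -/
theorem integral_log_one_add_mul_pos_s5 {Ω : Type*} [MeasurableSpace Ω] {P : Measure Ω}
    [IsFiniteMeasure P] {X : Ω → ℝ} (hX : Measurable X) (hfin : (Set.range X).Finite)
    (hneg : 0 < P {ω | X ω < 0}) {l m : ℝ} (hm : 0 < m) (hml : m < l)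
    (hpos : ∀ ω, 0 < 1 + l * X ω) (hroot : ∫ ω, Real.log (1 + l * X ω) ∂P = 0) :
    0 < ∫ ω, Real.log (1 + m * X ω) ∂P := by
  have hl : 0 < l := hm.trans hml
  have hlt : ∀ ω, X ω ≠ 0 →
      m / l * Real.log (1 + l * X ω) < Real.log (1 + m * X ω) := by
    intro ω hω
    have h := mul_log_one_add_lt_log_one_add_mul (s := l * X ω) (t := m / l)
      (by linarith [hpos ω]) (mul_ne_zero hl.ne' hω) (div_pos hm hl) ((div_lt_one hl).2 hml)
    rwa [← mul_assoc, div_mul_cancel₀ m hl.ne'] at h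
  have hiX := integrable_log_one_add_mul_of_finite_range (P := P) hX hfin
  have hint := (hiX m).sub ((hiX l).const_mul (m / l))
  have key : 0 < ∫ ω, (Real.log (1 + m * X ω) - m / l * Real.log (1 + l * X ω)) ∂P := by
    refine (integral_pos_iff_support_of_nonneg (fun ω => ?_) hint).2
      (hneg.trans_le (measure_mono fun ω hω => ?_))
    · by_cases hω : X ω = 0
      · simp [hω]
      · exact sub_nonneg.2 (hlt ω hω).le
    · exact (sub_pos.2 (hlt ω (ne_of_lt hω))).ne'
  rwa [integral_sub (hiX m) ((hiX l).const_mul (m / l)), integral_const_mul, hroot, mul_zero,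
    sub_zero] at key

/-- monotonicity of the Foster–Hart riskiness: if `X ≤ Y` a.s. are
finite-valued gambles with maximal losses `LX`, `LY` and Foster–Hart roots
`λ_X ∈ (0, 1/LX)`, `λ_Y ∈ (0, 1/LY)` (the unique solutions of `E[log(1+λX)] = 0`,
`E[log(1+λY)] = 0`), then `λ_X ≤ λ_Y`, i.e. `R(Y) = 1/λ_Y ≤ 1/λ_X = R(X)`. -/
theorem fosterHart_riskiness_monotone
    {Ω : Type*} [MeasurableSpace Ω] (P : Measure Ω) [IsProbabilityMeasure P]
    (X Y : Ω → ℝ) (hXmeas : Measurable X) (hYmeas : Measurable Y)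
    (hXfin : (Set.range X).Finite) (hYfin : (Set.range Y).Finite)
    (hEX : 0 < ∫ ω, X ω ∂P) (hXneg : 0 < P {ω | X ω < 0})
    (hEY : 0 < ∫ ω, Y ω ∂P) (hYneg : 0 < P {ω | Y ω < 0})
    (hXY : ∀ᵐ ω ∂P, X ω ≤ Y ω)
    (LX LY : ℝ) (hLX : 0 < LX) (hLY : 0 < LY)
    (hLXmax : ∀ ω, -X ω ≤ LX) (hLXatt : 0 < P {ω | X ω = -LX})
    (hLYmax : ∀ ω, -Y ω ≤ LY) (hLYatt : 0 < P {ω | Y ω = -LY})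
    (lamX lamY : ℝ)
    (hlamX : lamX ∈ Set.Ioo (0 : ℝ) (1 / LX))
    (hrootX : (∫ ω, Real.log (1 + lamX * X ω) ∂P) = 0)
    (huniqX : ∀ mu ∈ Set.Ioo (0 : ℝ) (1 / LX),
      (∫ ω, Real.log (1 + mu * X ω) ∂P) = 0 → mu = lamX)
    (hlamY : lamY ∈ Set.Ioo (0 : ℝ) (1 / LY))
    (hrootY : (∫ ω, Real.log (1 + lamY * Y ω) ∂P) = 0)
    (huniqY : ∀ mu ∈ Set.Ioo (0 : ℝ) (1 / LY),
      (∫ ω, Real.log (1 + mu * Y ω) ∂P) = 0 → mu = lamY) :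
    lamX ≤ lamY ∧ 1 / lamY ≤ 1 / lamX := by
  have hle : lamX ≤ lamY := by
    by_contra! hlt
    have hposX : ∀ c, 0 < c → c ≤ lamX → ∀ ω, 0 < 1 + c * X ω := by
      intro c hc hcl ω
      have h1 : c * LX < 1 := (lt_div_iff₀ hLX).1 (hcl.trans_lt hlamX.2)
      nlinarith [mul_le_mul_of_nonneg_left (hLXmax ω) hc.le]
    have hpos := integral_log_one_add_mul_pos_s5 hXmeas hXfin hXneg hlamY.1 hlt
      (hposX lamX hlamX.1 le_rfl) hrootX
    have hmono : ∫ ω, Real.log (1 + lamY * X ω) ∂P ≤ ∫ ω, Real.log (1 + lamY * Y ω) ∂P := by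
      refine integral_mono_ae (integrable_log_one_add_mul_of_finite_range hXmeas hXfin lamY)
        (integrable_log_one_add_mul_of_finite_range hYmeas hYfin lamY) ?_
      filter_upwards [hXY] with ω hω
      refine Real.log_le_log (hposX lamY hlamY.1 hlt.le ω) ?_
      linarith [mul_le_mul_of_nonneg_left hω hlamY.1.le]
    linarith
  exact ⟨hle, one_div_le_one_div_of_le hlamX.1 hle⟩
end

section
/- Let X be a gamble with maximal loss L(X) = 1 whose distribution has a strictly positive density on its support (either [-1, M] or [-1, ∞)). Let (X_n) be the increasing dyadic discretizations of X with X_n → X a.s., let λ_n ∈ (0,1) be the unique positive solution of E[log(1 + λ_n X_n)] = 0 (defined for all n large enough that E[X_n] > 0), and let λ_∞ = lim_n λ_n ≤ 1. If E[log(1 + X)] < 0, then λ_∞ < 1 and λ_∞ is the unique positive solution of E[log(1 + λ X)] = 0. -/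
open MeasureTheory Filter

/-- A bound for `log (1 + l * y)` that is uniform over `l ≤ d < 1` and `-1 ≤ y ≤ x`. -/
theorem abs_log_one_add_mul_le {l d x y : ℝ} (hl0 : 0 ≤ l) (hld : l ≤ d) (hd : d < 1)
    (hy : -1 ≤ y) (hyx : y ≤ x) : |Real.log (1 + l * y)| ≤ |x| - Real.log (1 - d) := by
  have h1 : 1 - d ≤ 1 + l * y := by nlinarith
  have h2 : Real.log (1 - d) ≤ Real.log (1 + l * y) := Real.log_le_log (by linarith) h1
  have h3 : Real.log (1 - d) ≤ 0 := Real.log_nonpos (by linarith) (by linarith)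
  have h4 := Real.log_le_sub_one_of_pos (show 0 < 1 + l * y by linarith)
  have h5 : l * y ≤ |x| := by
    rcases le_total 0 y with h0 | h0
    · nlinarith [le_abs_self x]
    · nlinarith [abs_nonneg x]
  rw [abs_le]
  constructor <;> linarith [abs_nonneg x]

/-- A bound for `log (1 + l * x)` that is uniform over `0 ≤ l ≤ 1`. -/
theorem abs_log_one_add_mul_le_of_le_one {l x : ℝ} (hl0 : 0 ≤ l) (hl1 : l ≤ 1) (hx : -1 < x) :
    |Real.log (1 + l * x)| ≤ |x| + |Real.log (1 + x)| := by
  rcases le_total 0 x with h0 | h0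
  · have hlx : 0 ≤ l * x := mul_nonneg hl0 h0
    have h4 := Real.log_le_sub_one_of_pos (show 0 < 1 + l * x by linarith)
    rw [abs_of_nonneg (Real.log_nonneg (by linarith)), abs_of_nonneg h0]
    nlinarith [abs_nonneg (Real.log (1 + x))]
  · have h1 : 1 + x ≤ 1 + l * x := by nlinarith
    have h2 := Real.log_le_log (by linarith) h1
    rw [abs_of_nonpos (Real.log_nonpos (by linarith) (by nlinarith))]
    linarith [abs_nonneg x, neg_abs_le (Real.log (1 + x))]

theorem div_mul_log_one_add_mul_lt {a b x : ℝ} (ha : 0 < a) (hab : a < b) (hbx : 0 < 1 + b * x)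
    (hx0 : x ≠ 0) : a / b * Real.log (1 + b * x) < Real.log (1 + a * x) := by
  have hb : 0 < b := ha.trans hab
  have hne : (1 : ℝ) ≠ 1 + b * x := by
    simp [hb.ne', hx0]
  have ht : a / b < 1 := (div_lt_one hb).2 hab
  have := strictConcaveOn_log_Ioi.2 (Set.mem_Ioi.2 one_pos) (Set.mem_Ioi.2 hbx) hne
    (sub_pos.2 ht) (div_pos ha hb) (by ring)
  simp only [smul_eq_mul, Real.log_one, mul_zero, zero_add] at this
  have he : 1 - a / b + a / b * (1 + b * x) = 1 + a * x := by
    field_simp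
    ring
  rwa [mul_one, he] at this

theorem integrable_log_one_add_mul {Ω : Type*} [MeasurableSpace Ω] {P : Measure Ω}
    [IsFiniteMeasure P] {X Y : Ω → ℝ} (hY : Measurable Y) (hXint : Integrable X P)
    (hlb : ∀ ω, -1 ≤ Y ω) (hle : ∀ ω, Y ω ≤ X ω) {l : ℝ} (hl0 : 0 ≤ l) (hl1 : l < 1) :
    Integrable (fun ω => Real.log (1 + l * Y ω)) P :=
  (hXint.abs.sub (integrable_const (Real.log (1 - l)))).mono'
    (show Measurable fun ω => Real.log (1 + l * Y ω) by fun_prop).aestronglyMeasurable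
    (.of_forall fun ω => abs_log_one_add_mul_le hl0 le_rfl hl1 (hlb ω) (hle ω))

/-- The expected log growth rate has at most one zero in `(0, 1)`. -/
theorem not_lt_of_integral_log_one_add_mul_eq_zero {Ω : Type*} [MeasurableSpace Ω]
    {P : Measure Ω} [IsFiniteMeasure P] {X : Ω → ℝ} (hX : Measurable X) (hXint : Integrable X P)
    (hlb : ∀ ω, -1 ≤ X ω) (hEX : ∫ ω, X ω ∂P ≠ 0) {a b : ℝ} (ha : 0 < a) (hb : b < 1)
    (ha0 : ∫ ω, Real.log (1 + a * X ω) ∂P = 0) (hb0 : ∫ ω, Real.log (1 + b * X ω) ∂P = 0) :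
    ¬ a < b := by
  intro hab
  have hIa := integrable_log_one_add_mul hX hXint hlb (fun _ => le_rfl) ha.le (hab.trans hb)
  have hIb := (integrable_log_one_add_mul hX hXint hlb (fun _ => le_rfl)
    (ha.trans hab).le hb).const_mul (a / b)
  have hpos : ∀ ω, 0 < 1 + b * X ω := fun ω => by nlinarith [hlb ω]
  have hlt : ∀ ω, X ω ≠ 0 → 0 < Real.log (1 + a * X ω) - a / b * Real.log (1 + b * X ω) :=
    fun ω h0 => sub_pos.2 (div_mul_log_one_add_mul_lt ha hab (hpos ω) h0)
  have hz : ∫ ω, (Real.log (1 + a * X ω) - a / b * Real.log (1 + b * X ω)) ∂P = 0 := by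
    rw [integral_sub hIa hIb, integral_const_mul, ha0, hb0]
    simp
  rw [integral_eq_zero_iff_of_nonneg ?_ (by exact hIa.sub hIb)] at hz
  · refine hEX (integral_eq_zero_of_ae ?_)
    filter_upwards [hz] with ω hω
    by_contra h0
    exact (hlt ω h0).ne' hω
  · intro ω
    by_cases h0 : X ω = 0
    · simp [h0]
    · exact (hlt ω h0).le

/-- let `X` be a gamble with maximal loss normalized to `1` (so `X ≥ −1`
a.s.), approximated from below by nondecreasing finite-valued discretizations
`X_n ↑ X` a.s., with Foster–Hart roots `λ_n ∈ (0,1)` (for `n ≥ N`),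
`λ_n` nondecreasing with limit `λ_∞`.  If `E[log(1 + X)] < 0` then `λ_∞ < 1` and
`λ_∞` is the unique positive solution of `E[log(1 + λX)] = 0`. -/
theorem fosterHart_limit_root_of_neg
    {Ω : Type*} [MeasurableSpace Ω] (P : Measure Ω) [IsProbabilityMeasure P]
    (X : Ω → ℝ) (hXmeas : Measurable X) (hXint : Integrable X P)
    (hXlb : ∀ᵐ ω ∂P, -1 ≤ X ω)
    (hEX : 0 < ∫ ω, X ω ∂P) (hXneg : 0 < P {ω | X ω < 0})
    (Xn : ℕ → Ω → ℝ) (hXnmeas : ∀ n, Measurable (Xn n))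
    (hXnfin : ∀ n, (Set.range (Xn n)).Finite)
    (hmono : ∀ ω, Monotone fun n => Xn n ω)
    (hle : ∀ n ω, Xn n ω ≤ X ω) (hlb : ∀ n ω, -1 ≤ Xn n ω)
    (htend : ∀ᵐ ω ∂P, Tendsto (fun n => Xn n ω) atTop (nhds (X ω)))
    (N : ℕ) (lam : ℕ → ℝ)
    (hlam : ∀ n, N ≤ n → lam n ∈ Set.Ioo (0 : ℝ) 1 ∧
      (∫ ω, Real.log (1 + lam n * Xn n ω) ∂P) = 0)
    (hlammono : ∀ m n, N ≤ m → m ≤ n → lam m ≤ lam n)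
    (laminf : ℝ) (hlim : Tendsto lam atTop (nhds laminf))
    (h : (∫ ω, Real.log (1 + X ω) ∂P) < 0) :
    laminf < 1 ∧ 0 < laminf ∧
    (∫ ω, Real.log (1 + laminf * X ω) ∂P) = 0 ∧
    (∀ mu ∈ Set.Ioc (0 : ℝ) 1,
      (∫ ω, Real.log (1 + mu * X ω) ∂P) = 0 → mu = laminf) := by
  have hXlb' : ∀ ω, -1 ≤ X ω := fun ω => (hlb 0 ω).trans (hle 0 ω)
  have hlogint : Integrable (fun ω => Real.log (1 + X ω)) P := .of_integral_ne_zero h.ne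
  have hlaminf : ∀ n, N ≤ n → lam n ≤ laminf := fun n hn =>
    ge_of_tendsto hlim (eventually_atTop.2 ⟨n, fun m hm => hlammono n m hn hm⟩)
  have hpos : 0 < laminf := (hlam N le_rfl).1.1.trans_le (hlaminf N le_rfl)
  have hle1 : laminf ≤ 1 :=
    le_of_tendsto hlim (eventually_atTop.2 ⟨N, fun n hn => (hlam n hn).1.2.le⟩)
  have hlt1 : laminf < 1 := by
    refine lt_of_le_of_ne hle1 fun h1 => ?_
    subst h1
    set Z : ℝ → Ω → ℝ := fun l => {ω | X ω ≠ -1}.indicator fun ω => Real.log (1 + l * X ω) with hZ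
    have hms : MeasurableSet {ω | X ω ≠ -1} := (hXmeas (measurableSet_singleton (-1))).compl
    have hZmeas : ∀ l, Measurable (Z l) := fun l => Measurable.indicator (by fun_prop) hms
    have hbound : ∀ l, 0 ≤ l → l ≤ 1 → ∀ ω, ‖Z l ω‖ ≤ |X ω| + |Real.log (1 + X ω)| := by
      intro l hl0 hl1 ω
      by_cases hω : X ω = -1
      · simp [hZ, hω]
      · simpa [hZ, hω] using
          abs_log_one_add_mul_le_of_le_one hl0 hl1 (lt_of_le_of_ne (hXlb' ω) (Ne.symm hω))
    have hdom : Integrable (fun ω => |X ω| + |Real.log (1 + X ω)|) P := hXint.abs.add hlogint.abs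
    have hconv : Tendsto (fun n => ∫ ω, Z (lam n) ω ∂P) atTop
        (nhds (∫ ω, Real.log (1 + X ω) ∂P)) := by
      refine tendsto_integral_filter_of_dominated_convergence _
        (.of_forall fun n => (hZmeas _).aestronglyMeasurable)
        (eventually_atTop.2 ⟨N, fun n hn => .of_forall
          (hbound _ (hlam n hn).1.1.le (hlam n hn).1.2.le)⟩) hdom (.of_forall fun ω => ?_)
      by_cases hω : X ω = -1
      · simp [hZ, hω]
      · have h0 : 1 + 1 * X ω ≠ 0 := fun h => hω (by linarith)
        simpa [hZ, hω] using ((hlim.mul_const (X ω)).const_add 1).log h0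
    refine h.not_ge (ge_of_tendsto hconv (eventually_atTop.2 ⟨N, fun n hn => ?_⟩))
    obtain ⟨⟨hl0, hl1⟩, hroot⟩ := hlam n hn
    rw [← hroot]
    refine integral_mono
      (integrable_log_one_add_mul (hXnmeas n) hXint (hlb n) (hle n) hl0.le hl1)
      (hdom.mono' (hZmeas _).aestronglyMeasurable (.of_forall (hbound _ hl0.le hl1.le)))
      fun ω => ?_
    by_cases hω : X ω = -1
    · have hXn : Xn n ω = -1 := le_antisymm (hω ▸ hle n ω) (hlb n ω)
      simpa [hZ, hω, hXn] using
        Real.log_nonpos (x := 1 + -lam n) (by linarith) (by linarith)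
    · simp only [hZ, Set.indicator, Set.mem_ofPred_eq, ne_eq, hω, not_false_eq_true, if_true]
      exact Real.log_le_log (by nlinarith [hlb n ω]) (by nlinarith [hle n ω])
  have hroot : ∫ ω, Real.log (1 + laminf * X ω) ∂P = 0 := by
    have hconv : Tendsto (fun n => ∫ ω, Real.log (1 + lam n * Xn n ω) ∂P) atTop
        (nhds (∫ ω, Real.log (1 + laminf * X ω) ∂P)) := by
      refine tendsto_integral_filter_of_dominated_convergence
        (fun ω => |X ω| - Real.log (1 - laminf))
        (.of_forall fun n => (show Measurable fun ω => Real.log (1 + lam n * Xn n ω) from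
          (((hXnmeas n).const_mul _).const_add 1).log).aestronglyMeasurable)
        (eventually_atTop.2 ⟨N, fun n hn => .of_forall fun ω =>
          abs_log_one_add_mul_le (hlam n hn).1.1.le (hlaminf n hn) hlt1 (hlb n ω) (hle n ω)⟩)
        (hXint.abs.sub (integrable_const _)) ?_
      filter_upwards [htend] with ω hω
      exact ((hlim.mul hω).const_add 1).log (by nlinarith [hXlb' ω])
    refine tendsto_nhds_unique hconv (tendsto_const_nhds.congr' ?_)
    exact eventually_atTop.2 ⟨N, fun n hn => (hlam n hn).2.symm⟩
  refine ⟨hlt1, hpos, hroot, fun mu hmu hmu0 => ?_⟩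
  have hmu1 : mu < 1 := lt_of_le_of_ne hmu.2 fun h1 => h.ne (by simpa [h1] using hmu0)
  exact le_antisymm
    (not_lt.1 (not_lt_of_integral_log_one_add_mul_eq_zero hXmeas hXint hXlb' hEX.ne' hpos hmu1
      hroot hmu0))
    (not_lt.1 (not_lt_of_integral_log_one_add_mul_eq_zero hXmeas hXint hXlb' hEX.ne' hmu.1 hlt1
      hmu0 hroot))
end
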